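/- arXiv:1307.0827 — 2 statements merged into one kernel-verified Lean document; each statement's English description precedes it below -/
import Mathlib

section
/- Let ρ₁ and ρ₂ be density matrices on a finite-dimensional complex Hilbert space H, and let 0 < p < 1. There exists an effect E with 0 ≤ E ≤ I achieving perfect reliability p·tr(E ρ₁) + (1−p)·tr((I−E) ρ₂) = 1 if and only if ρ₁·ρ₂ = 0 (equivalently, the supports of ρ₁ and ρ₂ are mutually orthogonal subspaces). In particular, whenever the supports of ρ₁ and ρ₂ are not orthogonal, every experiment distinguishes them with reliability strictly less than 1. -/
open scoped InnerProductSpace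

open ContinuousLinearMap InnerProductSpace in
/-- The trace of the product of two positive operators is a sum of squared moduli. -/
theorem ContinuousLinearMap.IsPositive.exists_trace_comp_eq
    {H : Type*} [NormedAddCommGroup H] [InnerProductSpace ℂ H] [FiniteDimensional ℂ H]
    {A B : H →L[ℂ] H} (hA : A.IsPositive) (hB : B.IsPositive) :
    ∃ (m n : ℕ) (u : Fin m → H) (v : Fin n → H),
      A ∘L B = ∑ i, ∑ j, rankOne ℂ (u i) (u i) ∘L rankOne ℂ (v j) (v j) ∧
      (LinearMap.trace ℂ H ↑(A ∘L B)).re = ∑ i, ∑ j, ‖⟪u i, v j⟫_ℂ‖ ^ 2 := by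
  obtain ⟨m, u, rfl⟩ := isPositive_iff_eq_sum_rankOne.mp hA
  obtain ⟨n, v, rfl⟩ := isPositive_iff_eq_sum_rankOne.mp hB
  have h : (∑ i, rankOne ℂ (u i) (u i)) ∘L (∑ j, rankOne ℂ (v j) (v j)) =
      ∑ i, ∑ j, rankOne ℂ (u i) (u i) ∘L rankOne ℂ (v j) (v j) := by
    simp only [← ContinuousLinearMap.mul_def, Finset.sum_mul_sum]
  refine ⟨m, n, u, v, h, ?_⟩
  rw [h]
  simp only [ContinuousLinearMap.toLinearMap_sum, map_sum, Complex.re_sum, rankOne_comp_rankOne,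
    ContinuousLinearMap.toLinearMap_smul, map_smul, trace_rankOne, smul_eq_mul]
  refine Finset.sum_congr rfl fun i _ ↦ Finset.sum_congr rfl fun j _ ↦ ?_
  rw [← inner_conj_symm (v j) (u i), RCLike.mul_conj]
  norm_cast

theorem ContinuousLinearMap.IsPositive.re_trace_comp_nonneg
    {H : Type*} [NormedAddCommGroup H] [InnerProductSpace ℂ H] [FiniteDimensional ℂ H]
    {A B : H →L[ℂ] H} (hA : A.IsPositive) (hB : B.IsPositive) :
    0 ≤ (LinearMap.trace ℂ H ↑(A ∘L B)).re := by
  obtain ⟨m, n, u, v, -, h⟩ := hA.exists_trace_comp_eq hB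
  rw [h]
  positivity

theorem ContinuousLinearMap.IsPositive.comp_eq_zero_of_re_trace_eq_zero
    {H : Type*} [NormedAddCommGroup H] [InnerProductSpace ℂ H] [FiniteDimensional ℂ H]
    {A B : H →L[ℂ] H} (hA : A.IsPositive) (hB : B.IsPositive)
    (h0 : (LinearMap.trace ℂ H ↑(A ∘L B)).re = 0) : A ∘L B = 0 := by
  obtain ⟨m, n, u, v, hAB, h⟩ := hA.exists_trace_comp_eq hB
  rw [h0, eq_comm, Finset.sum_eq_zero_iff_of_nonneg fun i _ ↦ by positivity] at h
  rw [hAB]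
  refine Finset.sum_eq_zero fun i hi ↦ Finset.sum_eq_zero fun j hj ↦ ?_
  have hij := (Finset.sum_eq_zero_iff_of_nonneg fun j _ ↦ by positivity).mp (h i hi) j hj
  have : ⟪u i, v j⟫_ℂ = 0 := by simpa using hij
  simp [InnerProductSpace.rankOne_comp_rankOne, this]

theorem ContinuousLinearMap.re_trace_one_sub_comp
    {H : Type*} [NormedAddCommGroup H] [InnerProductSpace ℂ H] [FiniteDimensional ℂ H]
    (E : H →L[ℂ] H) {ρ : H →L[ℂ] H} (hρ : LinearMap.trace ℂ H ↑ρ = 1) :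
    (LinearMap.trace ℂ H ↑((1 - E) ∘L ρ)).re = 1 - (LinearMap.trace ℂ H ↑(E ∘L ρ)).re := by
  have h : (1 - E) ∘L ρ = ρ - E ∘L ρ := by ext; simp
  rw [h, ContinuousLinearMap.toLinearMap_sub, map_sub, hρ, Complex.sub_re, Complex.one_re]

open scoped InnerProductSpace

/-- Let `ρ₁, ρ₂` be density matrices on a finite-dimensional complex Hilbert space and
`0 < p < 1`. There exists an effect `E` (`0 ≤ E ≤ I`) achieving perfect reliability
`p·tr(E ρ₁) + (1-p)·tr((I-E) ρ₂) = 1` if and only if `ρ₁·ρ₂ = 0` (equivalently, the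
supports of `ρ₁` and `ρ₂` are mutually orthogonal). In particular, whenever the
supports are not orthogonal, every experiment distinguishes the two density matrices
with reliability strictly less than `1`. -/
theorem stmt_14
    {H : Type*} [NormedAddCommGroup H] [InnerProductSpace ℂ H] [FiniteDimensional ℂ H]
    (ρ₁ ρ₂ : H →L[ℂ] H)
    (hρ₁ : ρ₁.IsPositive) (hρ₁tr : LinearMap.trace ℂ H ↑ρ₁ = 1)
    (hρ₂ : ρ₂.IsPositive) (hρ₂tr : LinearMap.trace ℂ H ↑ρ₂ = 1)
    (p : ℝ) (hp0 : 0 < p) (hp1 : p < 1) :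
    (∃ E : H →L[ℂ] H, E.IsPositive ∧ (1 - E).IsPositive ∧
      p * (LinearMap.trace ℂ H ↑(E ∘L ρ₁)).re
        + (1 - p) * (LinearMap.trace ℂ H ↑((1 - E) ∘L ρ₂)).re = 1)
    ↔ ρ₁ ∘L ρ₂ = 0 := by
  constructor
  · rintro ⟨E, hE, hE', h⟩
    have h₁ := hE'.re_trace_comp_nonneg hρ₁
    have h₂ := hE.re_trace_comp_nonneg hρ₂
    have e₁ := E.re_trace_one_sub_comp hρ₁tr
    have e₂ := E.re_trace_one_sub_comp hρ₂tr
    have z₁ : (1 - E) ∘L ρ₁ = 0 := hE'.comp_eq_zero_of_re_trace_eq_zero hρ₁ (by nlinarith)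
    have z₂ : E ∘L ρ₂ = 0 := hE.comp_eq_zero_of_re_trace_eq_zero hρ₂ (by nlinarith)
    have z₃ : ρ₁ ∘L (1 - E) = 0 := by
      have := congrArg star z₁
      simpa [← ContinuousLinearMap.mul_def, hE'.isSelfAdjoint.star_eq,
        hρ₁.isSelfAdjoint.star_eq, -star_sub] using this
    calc ρ₁ ∘L ρ₂ = ρ₁ ∘L (1 - E) ∘L ρ₂ + ρ₁ ∘L E ∘L ρ₂ := by ext; simp
      _ = 0 := by rw [← ContinuousLinearMap.comp_assoc, z₃, z₂]; simp
  · intro h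
    set K := (ρ₁ : H →ₗ[ℂ] H).range
    have k₁ : K.starProjection ∘L ρ₁ = ρ₁ := by
      ext x
      exact Submodule.starProjection_eq_self_iff.mpr ⟨x, rfl⟩
    have k₂ : K.starProjection ∘L ρ₂ = 0 := by
      ext x
      refine (Submodule.starProjection_apply_eq_zero_iff _).mpr ?_
      rintro _ ⟨y, rfl⟩
      have hx : ρ₁ (ρ₂ x) = 0 := DFunLike.congr_fun h x
      exact (hρ₁.inner_left_eq_inner_right y (ρ₂ x)).trans (by rw [hx, inner_zero_right])
    refine ⟨K.starProjection, .of_isStarProjection isStarProjection_starProjection,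
      .of_isStarProjection isStarProjection_starProjection.one_sub, ?_⟩
    rw [ContinuousLinearMap.re_trace_one_sub_comp _ hρ₂tr, k₁, k₂, hρ₁tr]
    simp
end

section
/- (Proposition 6.) Let u be the uniform probability measure on the unit sphere of ℂ^n and let p ∈ [0,1] satisfy p < 1/2 − 1/√8 or p > 1/2 + 1/√8. Then for every effect E on ℂ^n, the set S_E = { ψ ∈ S(ℂ^n) : R_ψ(E) > max{p, 1−p} } of wave functions on which E beats blind guessing satisfies u(S_E) ≤ 1/2. -/
open scoped InnerProductSpace
open MeasureTheory Finset

noncomputable section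

abbrev Vn (n : ℕ) : Type := EuclideanSpace ℂ (Fin n)

/-- The standard orthonormal basis vector `b_k` of `ℂ^n`. -/
def basisVec (n : ℕ) (k : Fin n) : Vn n := EuclideanSpace.single k 1

/-- The rank-one operator `|w⟩⟨v|`, i.e. `x ↦ ⟪v, x⟫ • w`. -/
def rankOne {n : ℕ} (v w : Vn n) : Vn n →L[ℂ] Vn n :=
  (innerSL ℂ v).smulRight w

/-- The diagonal part `diag E = ∑ₖ ⟪bₖ, E bₖ⟫ |bₖ⟩⟨bₖ|` of an operator `E`
in the standard basis. -/
def diagOp {n : ℕ} (E : Vn n →L[ℂ] Vn n) : Vn n →L[ℂ] Vn n :=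
  ∑ k : Fin n, ⟪basisVec n k, E (basisVec n k)⟫_ℂ • rankOne (basisVec n k) (basisVec n k)

/-- An effect: an operator `E` with `0 ≤ E ≤ I`
(both `E` and `I - E` positive semidefinite). -/
def IsEffect {n : ℕ} (E : Vn n →L[ℂ] Vn n) : Prop :=
  E.IsPositive ∧ (1 - E).IsPositive

/-- The reliability `R_ψ(E) = p⟪ψ, (diag E)ψ⟫ + (1-p)⟪ψ, (I-E)ψ⟫` of the yes–no
experiment with effect `E` for detecting a collapse (of probability `p`) onto the
standard basis, given initial wave function `ψ`. -/
def reliability {n : ℕ} (p : ℝ) (E : Vn n →L[ℂ] Vn n) (ψ : Vn n) : ℝ :=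
  p * (⟪ψ, diagOp E ψ⟫_ℂ).re + (1 - p) * (⟪ψ, (1 - E) ψ⟫_ℂ).re
/-- The map induced on the unit sphere of `ℂⁿ` by a unitary (linear isometric)
transformation `U`. -/
def sphereMap {n : ℕ} (U : Vn n ≃ₗᵢ[ℂ] Vn n)
    (ψ : Metric.sphere (0 : Vn n) 1) : Metric.sphere (0 : Vn n) 1 :=
  ⟨U ψ, by
    rw [mem_sphere_zero_iff_norm, U.norm_map]
    exact mem_sphere_zero_iff_norm.mp ψ.2⟩


theorem exists_linearIsometryEquiv_apply_eq {V : Type*} [NormedAddCommGroup V]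
    [InnerProductSpace ℂ V] [FiniteDimensional ℂ V] {x y : V} (hx : ‖x‖ = 1) (hy : ‖y‖ = 1) :
    ∃ U : V ≃ₗᵢ[ℂ] V, U x = y := by
  let L : Submodule.span ℂ {x} →ₗᵢ[ℂ] V :=
    (LinearIsometry.toSpanSingleton ℂ V hy).comp
      (LinearIsometryEquiv.toSpanUnitSingleton x hx).symm.toLinearIsometry
  refine ⟨L.extend.toLinearIsometryEquiv rfl, ?_⟩
  have h := L.extend_apply ⟨x, Submodule.mem_span_singleton_self x⟩
  have h1 : (LinearIsometryEquiv.toSpanUnitSingleton x hx).symm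
      ⟨x, Submodule.mem_span_singleton_self x⟩ = (1 : ℂ) := by
    rw [LinearIsometryEquiv.symm_apply_eq]
    ext
    simp
  simpa [L, h1] using h

section Uniqueness

theorem real_inner_eq_re_complex_inner {n : ℕ} (x y : Vn n) :
    inner ℝ x y = (⟪x, y⟫_ℂ).re := by
  simp [PiLp.inner_apply]

theorem charFun_apply_linearIsometryEquiv {n : ℕ} {μ : Measure (Vn n)} (U : Vn n ≃ₗᵢ[ℂ] Vn n)
    (hμ : μ.map U = μ) (t : Vn n) : charFun μ (U t) = charFun μ t := by
  have hU : AEMeasurable U μ := U.continuous.measurable.aemeasurable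
  rw [charFun_apply, charFun_apply]
  nth_rewrite 1 [← hμ]
  rw [integral_map hU (Continuous.aestronglyMeasurable (by fun_prop))]
  simp only [real_inner_eq_re_complex_inner, LinearIsometryEquiv.inner_map_map]

/-- A unitarily invariant probability measure carried by the unit sphere is unique. -/
theorem measure_eq_of_unitarily_invariant {n : ℕ} {μ ν : Measure (Vn n)} [IsProbabilityMeasure μ]
    [IsProbabilityMeasure ν] (hμ : ∀ U : Vn n ≃ₗᵢ[ℂ] Vn n, μ.map U = μ)
    (hν : ∀ U : Vn n ≃ₗᵢ[ℂ] Vn n, ν.map U = ν) (hμ1 : ∀ᵐ x ∂μ, ‖x‖ = 1) (hν1 : ∀ᵐ x ∂ν, ‖x‖ = 1) :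
    μ = ν := by
  have key : ∀ (ρ : Measure (Vn n)) [IsProbabilityMeasure ρ], (∀ U : Vn n ≃ₗᵢ[ℂ] Vn n, ρ.map U = ρ) →
      ∀ (σ : Measure (Vn n)) [IsProbabilityMeasure σ], (∀ᵐ x ∂σ, ‖x‖ = 1) →
      ∀ (r : ℝ) (e : Vn n), ‖e‖ = 1 → ∫ y, charFun ρ (r • y) ∂σ = charFun ρ (r • e) := by
    intro ρ _ hρ σ _ hσ r e he
    have : ∀ᵐ y ∂σ, charFun ρ (r • y) = charFun ρ (r • e) := by
      filter_upwards [hσ] with y hy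
      obtain ⟨U, hU⟩ := exists_linearIsometryEquiv_apply_eq he hy
      rw [← hU, ← charFun_apply_linearIsometryEquiv U (hρ U) (r • e)]
      congr 1
      exact ((U : Vn n →ₗ[ℂ] Vn n).map_smul_of_tower r e).symm
    rw [integral_congr_ae this]
    simp
  refine Measure.ext_of_charFun (funext fun t => ?_)
  by_cases ht : t = 0
  · simp [ht]
  have ht' : ‖t‖ ≠ 0 := norm_ne_zero_iff.mpr ht
  have he : ‖(‖t‖⁻¹ : ℝ) • t‖ = 1 := by
    rw [norm_smul, norm_inv, norm_norm, inv_mul_cancel₀ ht']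
  have hte : ‖t‖ • ((‖t‖⁻¹ : ℝ) • t) = t := by rw [smul_smul, mul_inv_cancel₀ ht', one_smul]
  rw [← hte, ← key μ hμ ν hν1 _ _ he, ← key ν hν μ hμ1 _ _ he]
  simp only [charFun_apply]
  rw [integral_integral_swap]
  · simp only [inner_smul_right, real_inner_comm]
  · refine Integrable.of_bound (C := 1) (Continuous.aestronglyMeasurable ?_) ?_
    · unfold Function.uncurry
      fun_prop
    · refine Filter.Eventually.of_forall fun x => ?_
      simp only [Function.uncurry]
      rw [Complex.norm_exp_ofReal_mul_I]

end Uniqueness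

section Gaussian

/-- Lebesgue measure on `ℂⁿ`, as the product of the Lebesgue measures of the coordinates. -/
def lebesgueVn (n : ℕ) : Measure (Vn n) :=
  (volume : Measure (Fin n → ℂ)).map (WithLp.toLp 2)

instance (n : ℕ) : (lebesgueVn n).IsAddHaarMeasure :=
  (PiLp.continuousLinearEquiv 2 ℝ fun _ : Fin n => ℂ).symm.isAddHaarMeasure_map volume

theorem measurePreserving_lebesgueVn {n : ℕ} (U : Vn n ≃ₗᵢ[ℂ] Vn n) :
    MeasurePreserving U (lebesgueVn n) (lebesgueVn n) := by
  let U' : Vn n ≃ₗᵢ[ℝ] Vn n := ⟨U.toLinearEquiv.restrictScalars ℝ, U.norm_map⟩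
  have h : MeasurePreserving U (volume : Measure (Vn n)) volume := U'.measurePreserving
  rw [Measure.isAddLeftInvariant_eq_smul (lebesgueVn n) (volume : Measure (Vn n))]
  exact h.smul_measure _

theorem integral_exp_neg_mul_sq_norm_complex {b : ℝ} (hb : 0 < b) :
    ∫ z : ℂ, Real.exp (-b * ‖z‖ ^ 2) = Real.pi / b := by
  rw [GaussianFourier.integral_rexp_neg_mul_sq_norm hb]
  simp

theorem lintegral_exp_neg_sum_mul_sq_norm {n : ℕ} {b : Fin n → ℝ} (hb : ∀ i, 0 < b i) :
    ∫⁻ x, ENNReal.ofReal (Real.exp (-∑ i, b i * ‖x i‖ ^ 2)) ∂lebesgueVn n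
      = ENNReal.ofReal (∏ i, (Real.pi / b i)) := by
  have hpos : ∀ i, 0 < Real.pi / b i := fun i => div_pos Real.pi_pos (hb i)
  have hprod : ∀ x : Fin n → ℂ, Real.exp (-∑ i, b i * ‖x i‖ ^ 2)
      = ∏ i, Real.exp (-b i * ‖x i‖ ^ 2) := by
    intro x
    rw [← Real.exp_sum, ← Finset.sum_neg_distrib]
    simp only [neg_mul]
  have hint : ∀ i, Integrable fun z : ℂ => Real.exp (-b i * ‖z‖ ^ 2) := fun i => by
    by_contra h
    have := integral_exp_neg_mul_sq_norm_complex (hb i)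
    rw [integral_undef h] at this
    exact (hpos i).ne this
  rw [lebesgueVn, lintegral_map (by fun_prop) (WithLp.measurable_toLp 2 _)]
  simp only [hprod]
  rw [volume_pi, ← ofReal_integral_eq_lintegral_ofReal (Integrable.fintype_prod hint)
    (Filter.Eventually.of_forall fun x => Finset.prod_nonneg fun i _ => (Real.exp_pos _).le),
    ← volume_pi,
    integral_fintype_prod_volume_eq_prod (fun i (z : ℂ) => Real.exp (-b i * ‖z‖ ^ 2))]
  simp only [integral_exp_neg_mul_sq_norm_complex (hb _)]

/-- The density of the standard complex Gaussian measure on `ℂⁿ`. -/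
def gaussDensity (n : ℕ) (x : Vn n) : ENNReal :=
  ENNReal.ofReal (Real.exp (-‖x‖ ^ 2)) / ENNReal.ofReal (Real.pi ^ n)

theorem measurable_gaussDensity (n : ℕ) : Measurable (gaussDensity n) := by
  unfold gaussDensity
  fun_prop

/-- The standard complex Gaussian measure on `ℂⁿ`. -/
def gaussVn (n : ℕ) : Measure (Vn n) := (lebesgueVn n).withDensity (gaussDensity n)

/-- The moment generating function of a diagonal quadratic form under the complex Gaussian. -/
theorem lintegral_exp_gaussVn {n : ℕ} {a : Fin n → ℝ} (ha : ∀ i, a i < 1) :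
    ∫⁻ x, ENNReal.ofReal (Real.exp (∑ i, a i * ‖x i‖ ^ 2)) ∂gaussVn n
      = ENNReal.ofReal (∏ i, (1 - a i)⁻¹) := by
  have hπ : 0 < Real.pi ^ n := pow_pos Real.pi_pos n
  have h1 : ∀ x : Vn n, gaussDensity n x * ENNReal.ofReal (Real.exp (∑ i, a i * ‖x i‖ ^ 2))
      = ENNReal.ofReal (Real.exp (-∑ i, (1 - a i) * ‖x i‖ ^ 2))
        * (ENNReal.ofReal (Real.pi ^ n))⁻¹ := by
    intro x
    rw [gaussDensity, div_eq_mul_inv, mul_right_comm, ← ENNReal.ofReal_mul (Real.exp_pos _).le,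
      ← Real.exp_add, EuclideanSpace.norm_sq_eq]
    congr 4
    simp only [sub_mul, one_mul, Finset.sum_sub_distrib]
    ring
  rw [gaussVn, lintegral_withDensity_eq_lintegral_mul _ (measurable_gaussDensity n) (by fun_prop)]
  simp only [Pi.mul_apply, h1]
  rw [lintegral_mul_const _ (by fun_prop),
    lintegral_exp_neg_sum_mul_sq_norm fun i => sub_pos.mpr (ha i),
    ← ENNReal.ofReal_inv_of_pos hπ, ← ENNReal.ofReal_mul' (by positivity)]
  congr 1
  simp only [div_eq_mul_inv, Finset.prod_mul_distrib, Finset.prod_const, Finset.card_univ,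
    Fintype.card_fin]
  field_simp

instance (n : ℕ) : IsProbabilityMeasure (gaussVn n) := by
  have h := lintegral_exp_gaussVn (n := n) (a := fun _ => 0) fun _ => zero_lt_one
  exact ⟨by simpa using h⟩

theorem measurePreserving_gaussVn {n : ℕ} (U : Vn n ≃ₗᵢ[ℂ] Vn n) :
    MeasurePreserving U (gaussVn n) (gaussVn n) := by
  refine ⟨U.continuous.measurable, ?_⟩
  ext s hs
  rw [Measure.map_apply U.continuous.measurable hs, gaussVn,
    withDensity_apply _ (U.continuous.measurable hs), withDensity_apply _ hs,
    ← (measurePreserving_lebesgueVn U).setLIntegral_comp_preimage hs (measurable_gaussDensity n)]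
  simp only [gaussDensity, LinearIsometryEquiv.norm_map]

theorem gaussVn_singleton_zero {n : ℕ} [NeZero n] : gaussVn n {0} = 0 :=
  withDensity_absolutelyContinuous _ _ (measure_singleton 0)

/-- The unitarily invariant probability measure on the sphere gives a cone at most its Gaussian
measure. -/
theorem sphere_measure_le_gaussVn {n : ℕ}
    (u : Measure (Metric.sphere (0 : Vn n) 1)) [IsProbabilityMeasure u]
    (hinv : ∀ U : Vn n ≃ₗᵢ[ℂ] Vn n, Measure.map (sphereMap U) u = u)
    {s : Set (Vn n)} (hs : MeasurableSet s)
    (hcone : ∀ (r : ℝ) (x : Vn n), 0 < r → r • x ∈ s → x ∈ s) :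
    u (Subtype.val ⁻¹' s) ≤ gaussVn n s := by
  have : NeZero n := by
    refine ⟨fun h => ?_⟩
    subst h
    obtain ⟨x⟩ := u.nonempty_of_neZero
    have := norm_eq_of_mem_sphere x
    rw [Subsingleton.elim (x : Vn 0) 0, norm_zero] at this
    exact zero_ne_one this
  let N : Vn n → Vn n := fun x => (‖x‖⁻¹ : ℝ) • x
  have hN : Measurable N := by fun_prop
  have hne : ∀ᵐ x ∂gaussVn n, x ≠ 0 := by
    rw [ae_iff]
    simpa using gaussVn_singleton_zero
  have : IsProbabilityMeasure (u.map Subtype.val) :=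
    Measure.isProbabilityMeasure_map measurable_subtype_coe.aemeasurable
  have : IsProbabilityMeasure ((gaussVn n).map N) :=
    Measure.isProbabilityMeasure_map hN.aemeasurable
  have huniq : u.map Subtype.val = (gaussVn n).map N := by
    refine measure_eq_of_unitarily_invariant (fun U => ?_) (fun U => ?_) ?_ ?_
    · have hU : Measurable (sphereMap U) :=
        (U.continuous.measurable.comp measurable_subtype_coe).subtype_mk
      conv_rhs => rw [← hinv U]
      rw [Measure.map_map U.continuous.measurable measurable_subtype_coe,
        Measure.map_map measurable_subtype_coe hU]
      rfl
    · conv_rhs => rw [← (measurePreserving_gaussVn U).map_eq]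
      rw [Measure.map_map U.continuous.measurable hN,
        Measure.map_map hN U.continuous.measurable]
      congr 1
      ext1 x
      simp only [N, Function.comp_apply, LinearIsometryEquiv.norm_map]
      exact (U : Vn n →ₗ[ℂ] Vn n).map_smul_of_tower _ x
    · rw [ae_map_iff measurable_subtype_coe.aemeasurable
        (measurableSet_eq_fun measurable_norm measurable_const)]
      exact Filter.Eventually.of_forall norm_eq_of_mem_sphere
    · rw [ae_map_iff hN.aemeasurable (measurableSet_eq_fun measurable_norm measurable_const)]
      filter_upwards [hne] with x hx
      rw [norm_smul, norm_inv, norm_norm, inv_mul_cancel₀ (norm_ne_zero_iff.mpr hx)]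
  rw [← Measure.map_apply measurable_subtype_coe hs, huniq, Measure.map_apply hN hs]
  refine measure_mono_ae ?_
  filter_upwards [hne] with x hx hxs
  exact hcone _ x (inv_pos.mpr (norm_pos_iff.mpr hx)) hxs

end Gaussian

theorem one_sub_mul_one_add_le_prod {ι : Type*} (t : Finset ι) (x y : ι → ℝ)
    (hx : ∀ i, 0 ≤ x i) (hy : ∀ i, 0 ≤ y i) (hx1 : ∑ i ∈ t, x i ≤ 1) :
    (1 - ∑ i ∈ t, x i) * (1 + ∑ i ∈ t, y i) ≤ ∏ i ∈ t, (1 - x i + y i) := by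
  classical
  induction t using Finset.induction_on with
  | empty => simp
  | insert i t hi ih =>
    rw [Finset.sum_insert hi] at hx1
    rw [Finset.sum_insert hi, Finset.sum_insert hi, Finset.prod_insert hi]
    have hX := Finset.sum_nonneg fun j (_ : j ∈ t) => hx j
    have hY := Finset.sum_nonneg fun j (_ : j ∈ t) => hy j
    have hxi := hx i
    have hyi := hy i
    set X := ∑ j ∈ t, x j
    set Y := ∑ j ∈ t, y j
    refine le_trans ?_ (mul_le_mul_of_nonneg_left (ih (by linarith)) (by linarith))
    have h1 : 1 - (x i + X) ≤ (1 - x i) * (1 - X) := by nlinarith [mul_nonneg hxi hX]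
    have h2 : 1 + (y i + Y) ≤ (1 + y i) * (1 + Y) := by nlinarith [mul_nonneg hyi hY]
    have h3 : (1 - x i) * (1 + y i) ≤ 1 - x i + y i := by nlinarith [mul_nonneg hxi hyi]
    calc (1 - (x i + X)) * (1 + (y i + Y))
        ≤ ((1 - x i) * (1 - X)) * ((1 + y i) * (1 + Y)) :=
          mul_le_mul h1 h2 (by linarith) (mul_nonneg (by linarith) (by linarith))
      _ = ((1 - x i) * (1 + y i)) * ((1 - X) * (1 + Y)) := by ring
      _ ≤ (1 - x i + y i) * ((1 - X) * (1 + Y)) :=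
          mul_le_mul_of_nonneg_right h3 (mul_nonneg (by linarith) (by linarith))

/-- Chernoff's bound for a diagonal quadratic form under the complex Gaussian. -/
theorem gaussVn_pos_le_of_diagonal {n : ℕ} {g h : Fin n → ℝ} (hg : ∀ i, 0 ≤ g i)
    (hh : ∀ i, 0 ≤ h i) (hgh : ∑ i, g i = ∑ i, h i) {p : ℝ} (hp0 : 0 ≤ p)
    (hp : p < 1 / 2 - 1 / Real.sqrt 8) :
    gaussVn n {x | 0 < ∑ i, (p * g i - (1 - p) * h i) * ‖x i‖ ^ 2} ≤ 1 / 2 := by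
  obtain hT | hT := (Finset.sum_nonneg fun i (_ : i ∈ Finset.univ) => hg i).eq_or_lt
  · have hg0 : ∀ i, g i = 0 := by
      simpa [Finset.sum_eq_zero_iff_of_nonneg, hg] using hT.symm
    have hh0 : ∀ i, h i = 0 := by
      simpa [Finset.sum_eq_zero_iff_of_nonneg, hh] using (hT.trans hgh).symm
    simp [hg0, hh0]
  set T := ∑ i, g i with hTdef
  set q := Real.sqrt 8 with hq
  have hq2 : q ^ 2 = 8 := Real.sq_sqrt (by norm_num)
  have hq0 : 0 < q := Real.sqrt_pos.mpr (by norm_num)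
  have hqinv : q * (1 / q) = 1 := by field_simp
  have hpq : q * p < q / 2 - 1 := by nlinarith [mul_lt_mul_of_pos_left hp hq0]
  have hq3 : q < 3 := by nlinarith
  set s := q / T with hs
  have hs0 : 0 < s := div_pos hq0 hT
  have hsT : s * T = q := by rw [hs]; field_simp
  have hp1 : p < 1 := by nlinarith
  set a : Fin n → ℝ := fun i => s * (p * g i - (1 - p) * h i) with ha
  have hsg : ∑ i, s * p * g i = q * p := by
    rw [← Finset.mul_sum, ← hTdef, ← hsT]; ring
  have hsh : ∑ i, s * (1 - p) * h i = q * (1 - p) := by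
    rw [← Finset.mul_sum, ← hgh, ← hsT]; ring
  have hx : ∀ i, 0 ≤ s * p * g i := fun i => mul_nonneg (mul_nonneg hs0.le hp0) (hg i)
  have hy : ∀ i, 0 ≤ s * (1 - p) * h i := fun i =>
    mul_nonneg (mul_nonneg hs0.le (by linarith)) (hh i)
  have ha1 : ∀ i, a i < 1 := by
    intro i
    have := Finset.single_le_sum (fun j _ => hx j) (Finset.mem_univ i)
    have := hy i
    simp only [ha]
    nlinarith
  have hprod : 2 ≤ ∏ i, (1 - a i) := by
    have h1 := one_sub_mul_one_add_le_prod Finset.univ _ _ hx hy (by rw [hsg]; linarith)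
    rw [hsg, hsh] at h1
    have h2 : ∏ i, (1 - a i) = ∏ i, (1 - s * p * g i + s * (1 - p) * h i) :=
      Finset.prod_congr rfl fun i _ => by simp only [ha]; ring
    rw [h2]
    refine le_trans ?_ h1
    nlinarith [mul_pos hq0 (sub_pos.mpr hpq), mul_nonneg hq0.le hp0]
  have hsub : {x : Vn n | 0 < ∑ i, (p * g i - (1 - p) * h i) * ‖x i‖ ^ 2} ⊆
      {x | 1 ≤ ENNReal.ofReal (Real.exp (∑ i, a i * ‖x i‖ ^ 2))} := by
    intro x hx
    have : ∑ i, a i * ‖x i‖ ^ 2 = s * ∑ i, (p * g i - (1 - p) * h i) * ‖x i‖ ^ 2 := by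
      rw [Finset.mul_sum]
      exact Finset.sum_congr rfl fun i _ => by simp only [ha]; ring
    rw [Set.mem_ofPred_eq, this, ENNReal.one_le_ofReal]
    exact Real.one_le_exp (mul_pos hs0 hx).le
  calc gaussVn n _ ≤ gaussVn n _ := measure_mono hsub
    _ ≤ ∫⁻ x, ENNReal.ofReal (Real.exp (∑ i, a i * ‖x i‖ ^ 2)) ∂gaussVn n := by
      simpa using mul_meas_ge_le_lintegral (μ := gaussVn n)
        (f := fun x : Vn n => ENNReal.ofReal (Real.exp (∑ i, a i * ‖x i‖ ^ 2)))
        (by fun_prop) 1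
    _ = ENNReal.ofReal (∏ i, (1 - a i)⁻¹) := lintegral_exp_gaussVn ha1
    _ ≤ ENNReal.ofReal (1 / 2) := by
      refine ENNReal.ofReal_le_ofReal ?_
      rw [Finset.prod_inv_distrib, one_div]
      exact inv_anti₀ two_pos hprod
    _ = 1 / 2 := by
      rw [ENNReal.ofReal_div_of_pos two_pos, ENNReal.ofReal_one, ENNReal.ofReal_ofNat]

/-- Chernoff's bound for `p G - (1 - p) H` with `G`, `H` positive operators of equal trace. -/
theorem gaussVn_pos_le {n : ℕ} {G H : Vn n →L[ℂ] Vn n} (hG : G.IsPositive) (hH : H.IsPositive)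
    (htr : LinearMap.trace ℂ (Vn n) G = LinearMap.trace ℂ (Vn n) H) {p : ℝ} (hp0 : 0 ≤ p)
    (hp : p < 1 / 2 - 1 / Real.sqrt 8) :
    gaussVn n {x | 0 < p * (⟪x, G x⟫_ℂ).re - (1 - p) * (⟪x, H x⟫_ℂ).re} ≤ 1 / 2 := by
  let A : Vn n →ₗ[ℂ] Vn n := (p : ℂ) • (G : Vn n →ₗ[ℂ] Vn n) - ((1 - p : ℝ) : ℂ) • H
  have hA : A.IsSymmetric :=
    (hG.isSymmetric.smul (Complex.conj_ofReal p)).sub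
      (hH.isSymmetric.smul (Complex.conj_ofReal (1 - p)))
  have hre : ∀ x, (⟪x, A x⟫_ℂ).re = p * (⟪x, G x⟫_ℂ).re - (1 - p) * (⟪x, H x⟫_ℂ).re := by
    intro x
    simp [A]
  let f := hA.eigenvectorBasis (n := n) (by simp)
  let l := hA.eigenvalues (n := n) (by simp)
  have hAf : ∀ i, A (f i) = (l i : ℂ) • f i := hA.apply_eigenvectorBasis _
  have hl : ∀ i, l i = p * (⟪f i, G (f i)⟫_ℂ).re - (1 - p) * (⟪f i, H (f i)⟫_ℂ).re := by
    intro i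
    rw [← hre, hAf, inner_smul_right, inner_self_eq_norm_sq_to_K, f.norm_eq_one]
    simp
  have hquad : ∀ x, (⟪x, A x⟫_ℂ).re = ∑ i, l i * ‖f.repr x i‖ ^ 2 := by
    intro x
    rw [← f.sum_inner_mul_inner, Complex.re_sum]
    refine Finset.sum_congr rfl fun i _ => ?_
    rw [← hA, hAf, inner_smul_left, f.repr_apply_apply, Complex.conj_ofReal,
      mul_left_comm, ← inner_conj_symm x, ← Complex.normSq_eq_conj_mul_self,
      Complex.normSq_eq_norm_sq, ← Complex.ofReal_mul, Complex.ofReal_re]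
  have hsum : ∑ i, (⟪f i, G (f i)⟫_ℂ).re = ∑ i, (⟪f i, H (f i)⟫_ℂ).re := by
    rw [← Complex.re_sum, ← Complex.re_sum]
    rw [LinearMap.trace_eq_sum_inner _ f, LinearMap.trace_eq_sum_inner _ f] at htr
    exact congrArg Complex.re htr
  have hpre : {x | 0 < p * (⟪x, G x⟫_ℂ).re - (1 - p) * (⟪x, H x⟫_ℂ).re} =
      f.repr ⁻¹' {x | 0 < ∑ i, (p * (⟪f i, G (f i)⟫_ℂ).re
        - (1 - p) * (⟪f i, H (f i)⟫_ℂ).re) * ‖x i‖ ^ 2} := by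
    ext x
    simp only [Set.mem_preimage, Set.mem_ofPred_eq, ← hl]
    rw [← hre, hquad]
  rw [hpre, (measurePreserving_gaussVn f.repr).measure_preimage
    (measurableSet_lt measurable_const (by fun_prop)).nullMeasurableSet]
  exact gaussVn_pos_le_of_diagonal (fun i => hG.re_inner_nonneg_right _)
    (fun i => hH.re_inner_nonneg_right _) hsum hp0 hp

theorem sphere_measure_pos_le {n : ℕ}
    (u : Measure (Metric.sphere (0 : Vn n) 1)) [IsProbabilityMeasure u]
    (hinv : ∀ U : Vn n ≃ₗᵢ[ℂ] Vn n, Measure.map (sphereMap U) u = u)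
    {G H : Vn n →L[ℂ] Vn n} (hG : G.IsPositive) (hH : H.IsPositive)
    (htr : LinearMap.trace ℂ (Vn n) G = LinearMap.trace ℂ (Vn n) H) {p : ℝ} (hp0 : 0 ≤ p)
    (hp : p < 1 / 2 - 1 / Real.sqrt 8) :
    u {x | 0 < p * (⟪(x : Vn n), G x⟫_ℂ).re - (1 - p) * (⟪(x : Vn n), H x⟫_ℂ).re} ≤ 1 / 2 := by
  refine (sphere_measure_le_gaussVn u hinv
    (s := {x | 0 < p * (⟪x, G x⟫_ℂ).re - (1 - p) * (⟪x, H x⟫_ℂ).re}) ?_ ?_).trans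
    (gaussVn_pos_le hG hH htr hp0 hp)
  · exact (isOpen_lt continuous_const (by fun_prop)).measurableSet
  · intro r x hr hx
    have hsm : r • x = (r : ℂ) • x := (Complex.coe_smul r x).symm
    simp only [Set.mem_ofPred_eq, hsm, map_smul, inner_smul_left, inner_smul_right,
      Complex.conj_ofReal, Complex.re_ofReal_mul] at hx ⊢
    have : 0 < r ^ 2 * (p * (⟪x, G x⟫_ℂ).re - (1 - p) * (⟪x, H x⟫_ℂ).re) := by
      refine hx.trans_eq ?_
      ring
    exact pos_of_mul_pos_right this (by positivity)

theorem diagOp_isPositive {n : ℕ} {E : Vn n →L[ℂ] Vn n} (hE : E.IsPositive) :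
    (diagOp E).IsPositive :=
  ContinuousLinearMap.isPositive_sum _ fun k _ =>
    (InnerProductSpace.isPositive_rankOne_self (basisVec n k)).smul_of_nonneg
      (hE.inner_nonneg_right _)

theorem inner_basisVec_diagOp {n : ℕ} (E : Vn n →L[ℂ] Vn n) (k : Fin n) :
    ⟪basisVec n k, diagOp E (basisVec n k)⟫_ℂ = ⟪basisVec n k, E (basisVec n k)⟫_ℂ := by
  simp [diagOp, rankOne, basisVec, EuclideanSpace.inner_single_left]

theorem trace_diagOp {n : ℕ} (E : Vn n →L[ℂ] Vn n) :
    LinearMap.trace ℂ (Vn n) (diagOp E) = LinearMap.trace ℂ (Vn n) E := by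
  simp only [LinearMap.trace_eq_sum_inner _ (EuclideanSpace.basisFun (Fin n) ℂ)]
  refine Finset.sum_congr rfl fun k _ => ?_
  simpa [basisVec] using inner_basisVec_diagOp E k

theorem diagOp_one_sub {n : ℕ} (E : Vn n →L[ℂ] Vn n) : diagOp (1 - E) = 1 - diagOp E := by
  ext x i
  simp [diagOp, rankOne, basisVec, sub_mul, EuclideanSpace.inner_single_left, Pi.single_apply]

/-- (Proposition 6.) Let `u` be the uniform (unitarily invariant Borel) probability
measure on the unit sphere of `ℂⁿ` and let `p ∈ [0,1]` satisfy `p < 1/2 - 1/√8` or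
`p > 1/2 + 1/√8`. Then for every effect `E` on `ℂⁿ`, the set
`S_E = {ψ : R_ψ(E) > max{p, 1-p}}` of wave functions on which `E` beats blind
guessing satisfies `u(S_E) ≤ 1/2`. -/
theorem stmt_15 (n : ℕ)
    [MeasurableSpace (Vn n)] [BorelSpace (Vn n)]
    (u : Measure (Metric.sphere (0 : Vn n) 1)) [IsProbabilityMeasure u]
    (hinv : ∀ U : Vn n ≃ₗᵢ[ℂ] Vn n, Measure.map (sphereMap U) u = u)
    (p : ℝ) (hp : p ∈ Set.Icc (0 : ℝ) 1)
    (hfar : p < 1 / 2 - 1 / Real.sqrt 8 ∨ 1 / 2 + 1 / Real.sqrt 8 < p)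
    (E : Vn n →L[ℂ] Vn n) (hE : IsEffect E) :
    u {ψ : Metric.sphere (0 : Vn n) 1 |
        max p (1 - p) < reliability p E (ψ : Vn n)} ≤ 1 / 2 := by
  rename_i m _ _
  obtain rfl : m = WithLp.measurableSpace 2 _ :=
    BorelSpace.measurable_eq.trans BorelSpace.measurable_eq.symm
  have hone : ∀ ψ : Metric.sphere (0 : Vn n) 1, (⟪(ψ : Vn n), ψ⟫_ℂ).re = 1 := fun ψ => by
    rw [inner_self_eq_norm_sq_to_K, norm_eq_of_mem_sphere]
    simp
  have h8 : 0 < 1 / Real.sqrt 8 := by positivity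
  rcases hfar with hfar | hfar
  · refine le_trans (measure_mono fun ψ hψ => ?_) (sphere_measure_pos_le u hinv
      (diagOp_isPositive hE.1) hE.1 (trace_diagOp E) hp.1 hfar)
    simp only [Set.mem_ofPred_eq, reliability, sub_apply,
      one_apply_eq_self, inner_sub_right, Complex.sub_re, hone] at hψ ⊢
    have := le_max_right p (1 - p)
    linarith
  · refine le_trans (measure_mono fun ψ hψ => ?_) (sphere_measure_pos_le u hinv
      hE.2 (diagOp_isPositive hE.2) (trace_diagOp (1 - E)).symm
      (sub_nonneg.mpr hp.2) (by linarith))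
    simp only [Set.mem_ofPred_eq, reliability, diagOp_one_sub, sub_apply,
      one_apply_eq_self, inner_sub_right, Complex.sub_re, hone] at hψ ⊢
    have := le_max_left p (1 - p)
    linarith
end
end
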